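/- Let Γ ⊂ ℤ^n be an almost periodic pattern with D(Γ) > 0, let k ≥ 1 be an integer with k ≥ 1/D(Γ), and let S ⊂ ℝ^n be a centrally symmetric convex body with Leb(S) > 4^n·k. Then there exists a nonzero x ∈ S ∩ ℤ^n such that ρ_Γ(x) ≥ D(Γ)/2. -/

import Mathlib

open Filter MeasureTheory
open scoped BigOperators

noncomputable section

/-- The projection `p : ℝ → ℤ`: the unique `k` with `k - 1/2 < x ≤ k + 1/2`. -/
def roundHalf (x : ℝ) : ℤ := ⌈x - 1/2⌉

/-- Coercion of an integer vector to a real vector. -/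
def intVec {n : ℕ} (v : Fin n → ℤ) : Fin n → ℝ := fun i => (v i : ℝ)

/-- The set of integer points of `ℝ^n`. -/
def intPoints (n : ℕ) : Set (Fin n → ℝ) := Set.range (intVec (n := n))

/-- The coordinatewise projection `π : ℝ^n → ℤ^n`. -/
def discretize {n : ℕ} (x : Fin n → ℝ) : Fin n → ℤ := fun i => roundHalf (x i)

/-- `π` viewed as a self-map of `ℝ^n`. -/
def discretizeR {n : ℕ} (x : Fin n → ℝ) : Fin n → ℝ := intVec (discretize x)

/-- The image of a set `Γ` under the discretization `P̂` of the matrix `P`. -/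
def PhatImg {n : ℕ} (P : Matrix (Fin n) (Fin n) ℝ) (Γ : Set (Fin n → ℝ)) :
    Set (Fin n → ℝ) :=
  (fun x => discretizeR (P.mulVec x)) '' Γ

/-- The uniform `R`-density `D_R^+`. Balls are sup-norm balls. -/
def DRplus {n : ℕ} (Γ : Set (Fin n → ℝ)) (R : ℝ) : ℝ :=
  ⨆ x : Fin n → ℝ,
    ((Metric.ball x R ∩ Γ).ncard : ℝ) / ((Metric.ball x R ∩ intPoints n).ncard : ℝ)

/-- Relatively dense with parameter `R₀`. -/
def RelativelyDenseWith {n : ℕ} (Γ : Set (Fin n → ℝ)) (R₀ : ℝ) : Prop :=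
  ∀ x : Fin n → ℝ, ∀ r, R₀ ≤ r → (Metric.ball x r ∩ Γ).Nonempty

def RelativelyDense {n : ℕ} (Γ : Set (Fin n → ℝ)) : Prop :=
  ∃ R₀ > 0, RelativelyDenseWith Γ R₀

/-- Uniformly discrete with parameter `r₀`. -/
def UniformlyDiscreteWith {n : ℕ} (Γ : Set (Fin n → ℝ)) (r₀ : ℝ) : Prop :=
  ∀ x : Fin n → ℝ, ∀ r, 0 < r → r ≤ r₀ → (Metric.ball x r ∩ Γ).Subsingleton

def UniformlyDiscrete {n : ℕ} (Γ : Set (Fin n → ℝ)) : Prop :=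
  ∃ r₀ > 0, UniformlyDiscreteWith Γ r₀

def Delone {n : ℕ} (Γ : Set (Fin n → ℝ)) : Prop :=
  RelativelyDense Γ ∧ UniformlyDiscrete Γ

/-- The translateSet `Γ + v`. -/
def translateSet {n : ℕ} (Γ : Set (Fin n → ℝ)) (v : Fin n → ℝ) : Set (Fin n → ℝ) :=
  (· + v) '' Γ

/-- `N` is a set of `ε`-translations of `Γ` with radius `Rε`. -/
def IsEpsTranslationSet {n : ℕ} (Γ : Set (Fin n → ℝ)) (ε Rε : ℝ)
    (N : Set (Fin n → ℝ)) : Prop :=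
  N ⊆ intPoints n ∧ RelativelyDense N ∧
    ∀ R, Rε ≤ R → ∀ v ∈ N, DRplus (symmDiff (translateSet Γ v) Γ) R < ε

/-- Almost periodic pattern. -/
def AlmostPeriodicPattern {n : ℕ} (Γ : Set (Fin n → ℝ)) : Prop :=
  Γ ⊆ intPoints n ∧ Delone Γ ∧
    ∀ ε > 0, ∃ Rε > 0, ∃ N : Set (Fin n → ℝ), IsEpsTranslationSet Γ ε Rε N

/-- `Γ` has uniform density `D`. -/
def HasUnifDensity {n : ℕ} (Γ : Set (Fin n → ℝ)) (D : ℝ) : Prop :=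
  ∀ ε > 0, ∃ R₀ > 0, ∀ R, R₀ ≤ R → ∀ x : Fin n → ℝ,
    |((Metric.ball x R ∩ Γ).ncard : ℝ) / ((Metric.ball x R ∩ intPoints n).ncard : ℝ) - D| ≤ ε

/-- `Γ ∩ (Γ - v)`, the set of `x ∈ Γ` with `x + v ∈ Γ`. -/
def diffSet {n : ℕ} (Γ : Set (Fin n → ℝ)) (v : Fin n → ℝ) : Set (Fin n → ℝ) :=
  Γ ∩ {x | x + v ∈ Γ}

/-- `E` is equidistributed modulo `ℤ^n`: averages of continuous `ℤ^n`-periodic functions over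
`E ∩ B_R` converge to the Haar integral. -/
def EquidistributedModZn {n : ℕ} (E : Set (Fin n → ℝ)) : Prop :=
  ∀ f : (Fin n → ℝ) → ℝ, Continuous f →
    (∀ (x : Fin n → ℝ) (v : Fin n → ℤ), f (x + intVec v) = f x) →
    Filter.Tendsto (fun R : ℝ =>
        (∑ᶠ x ∈ E ∩ Metric.ball (0 : Fin n → ℝ) R, f x) /
          ((E ∩ Metric.ball (0 : Fin n → ℝ) R).ncard : ℝ))
      Filter.atTop
      (nhds (∫ x in Set.pi Set.univ (fun _ : Fin n => Set.Ico (0:ℝ) 1), f x))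

/-- `P` is totally irrational: `P(ℤ^n)` is equidistributed modulo `ℤ^n`. -/
def TotallyIrrational {n : ℕ} (P : Matrix (Fin n) (Fin n) ℝ) : Prop :=
  EquidistributedModZn (P.mulVec '' intPoints n)

/-- Rate of injectivity in time 1. -/
def tauOne {n : ℕ} (P : Matrix (Fin n) (Fin n) ℝ) : ℝ :=
  Filter.limsup (fun R : ℝ =>
    ((PhatImg P (intPoints n) ∩ Metric.ball (0 : Fin n → ℝ) R).ncard : ℝ) /
      ((intPoints n ∩ Metric.ball (0 : Fin n → ℝ) R).ncard : ℝ)) Filter.atTop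

/-- The successive images `(P̂_k ∘ ⋯ ∘ P̂_1)(Γ)`. -/
def seqImg {n : ℕ} (P : ℕ → Matrix (Fin n) (Fin n) ℝ) :
    ℕ → Set (Fin n → ℝ) → Set (Fin n → ℝ)
  | 0, Γ => Γ
  | k + 1, Γ => PhatImg (P (k + 1)) (seqImg P k Γ)

/-- Rate of injectivity in time `k` of the sequence `(P_k)`. -/
def tauK {n : ℕ} (P : ℕ → Matrix (Fin n) (Fin n) ℝ) (k : ℕ) : ℝ :=
  Filter.limsup (fun R : ℝ =>
    ((seqImg P k (intPoints n) ∩ Metric.ball (0 : Fin n → ℝ) R).ncard : ℝ) /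
      ((intPoints n ∩ Metric.ball (0 : Fin n → ℝ) R).ncard : ℝ)) Filter.atTop

/-- A fixed norm on `M_n(ℝ)`: the sup of absolute values of the entries. -/
def matNorm {n : ℕ} (A : Matrix (Fin n) (Fin n) ℝ) : ℝ :=
  ⨆ p : Fin n × Fin n, |A p.1 p.2|


/-- The function `φ_u`, a "weighted projection" of `u` on `ℤ^n`. -/
def phiFn {n : ℕ} (u : Fin n → ℝ) (v : Fin n → ℤ) : ℝ :=
  if ‖u - intVec v‖ < 1 then ∏ i, (1 - |u i - (v i : ℝ)|) else 0

/-- `I_ℚ(A)`: the set of indices `i` such that all entries of the `i`-th row of `A`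
are rational. -/
def IQ {n : ℕ} (A : Matrix (Fin n) (Fin n) ℝ) : Set (Fin n) :=
  {i | ∀ j, ∃ q : ℚ, A i j = (q : ℝ)}

/-- A sequence of matrices all lying in `O_n(ℝ)`. -/
def IsOnSeq {n : ℕ} (P : ℕ → Matrix (Fin n) (Fin n) ℝ) : Prop :=
  ∀ k, P k ∈ Matrix.orthogonalGroup (Fin n) ℝ

/-- The `ℓ^∞` distance on sequences of matrices. -/
def seqDist {n : ℕ} (P Q : ℕ → Matrix (Fin n) (Fin n) ℝ) : ℝ :=
  ⨆ k : ℕ, matNorm (P k - Q k)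

/-- Open subsets of `ℓ^∞(O_n(ℝ))`. -/
def IsOpenSeq {n : ℕ} (U : Set {P : ℕ → Matrix (Fin n) (Fin n) ℝ // IsOnSeq P}) : Prop :=
  ∀ P ∈ U, ∃ δ > 0, ∀ Q : {P : ℕ → Matrix (Fin n) (Fin n) ℝ // IsOnSeq P},
    seqDist P.1 Q.1 < δ → Q ∈ U

/-- Dense subsets of `ℓ^∞(O_n(ℝ))`. -/
def IsDenseSeq {n : ℕ} (U : Set {P : ℕ → Matrix (Fin n) (Fin n) ℝ // IsOnSeq P}) : Prop :=
  ∀ P : {P : ℕ → Matrix (Fin n) (Fin n) ℝ // IsOnSeq P}, ∀ δ > 0,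
    ∃ Q ∈ U, seqDist P.1 Q.1 < δ

/-- Averaging over translates of the unit cube: a set of volume larger than `K` has a translate
containing more than `K` integer points. -/
theorem exists_finset_card_gt_of_volume_gt {n : ℕ} {A : Set (Fin n → ℝ)} (hA : MeasurableSet A)
    (K : ℕ) (hK : (K : ENNReal) < volume A) :
    ∃ (x : Fin n → ℝ) (F : Finset (Fin n → ℤ)), K < F.card ∧ ∀ v ∈ F, intVec v + x ∈ A := by
  classical
  let b := Pi.basisFun ℝ (Fin n)
  let L := (Submodule.span ℤ (Set.range b)).toAddSubgroup
  have hfd : IsAddFundamentalDomain L (ZSpan.fundamentalDomain b) volume :=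
    ZSpan.isAddFundamentalDomain b volume
  have : Countable L := inferInstanceAs (Countable (Submodule.span ℤ (Set.range b)))
  have hvol : volume (ZSpan.fundamentalDomain b) = 1 := by
    rw [ZSpan.fundamentalDomain_pi_basisFun, Real.volume_pi_Ico]
    simp
  have hsum : volume A =
      ∫⁻ x in ZSpan.fundamentalDomain b, ∑' g : L, A.indicator 1 (g +ᵥ x) := by
    rw [lintegral_tsum, ← hfd.lintegral_eq_tsum'' (A.indicator 1), lintegral_indicator_one hA]
    intro g
    exact ((measurable_one.indicator hA).comp (measurable_const_vadd g)).aemeasurable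
  obtain ⟨x, hx⟩ : ∃ x, (K : ENNReal) < ∑' g : L, A.indicator 1 (g +ᵥ x) := by
    by_contra! h
    refine hK.not_ge ?_
    calc volume A ≤ ∫⁻ _ in ZSpan.fundamentalDomain b, (K : ENNReal) := by
          rw [hsum]; exact lintegral_mono h
      _ = K := by rw [setLIntegral_const, hvol, mul_one]
  rw [ENNReal.tsum_eq_iSup_sum, lt_iSup_iff] at hx
  obtain ⟨s, hs⟩ := hx
  have hint : ∀ g : L, ∃ v : Fin n → ℤ, intVec v = (g : Fin n → ℝ) := by
    intro g
    have hg := (b.mem_span_iff_repr_mem ℤ (g : Fin n → ℝ)).1 g.2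
    choose v hv using hg
    exact ⟨v, funext fun i => by simpa [b, intVec] using hv i⟩
  choose φ hφ using hint
  have hφinj : Function.Injective φ := fun g h hgh =>
    Subtype.ext (by rw [← hφ g, ← hφ h, hgh])
  refine ⟨x, (s.filter fun g => g +ᵥ x ∈ A).image φ, ?_, ?_⟩
  · rw [Finset.card_image_of_injective _ hφinj]
    simp only [Set.indicator_apply, Pi.one_apply, Finset.sum_boole] at hs
    exact_mod_cast hs
  · intro v hv
    obtain ⟨g, hg, rfl⟩ := Finset.mem_image.1 hv
    rw [hφ]
    exact (Finset.mem_filter.1 hg).2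

theorem intVec_injective {n : ℕ} : Function.Injective (intVec (n := n)) := fun v w h =>
  funext fun i => by simpa [intVec] using congrFun h i

theorem intVec_add {n : ℕ} (v w : Fin n → ℤ) : intVec (v + w) = intVec v + intVec w := by
  ext i; simp [intVec]

theorem intVec_sub {n : ℕ} (v w : Fin n → ℤ) : intVec (v - w) = intVec v - intVec w := by
  ext i; simp [intVec]

theorem finite_intVec_mem_ball {n : ℕ} (R : ℝ) :
    {v : Fin n → ℤ | intVec v ∈ Metric.ball (0 : Fin n → ℝ) R}.Finite := by
  refine (Set.finite_Icc (fun _ => -⌈R⌉) (fun _ => ⌈R⌉)).subset fun v hv => ?_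
  have h : ∀ i, |(v i : ℝ)| ≤ ⌈R⌉ := fun i =>
    ((norm_le_pi_norm (intVec v) i).trans (mem_ball_zero_iff.1 hv).le).trans (Int.le_ceil R)
  exact ⟨fun i => by exact_mod_cast (abs_le.1 (h i)).1,
    fun i => by exact_mod_cast (abs_le.1 (h i)).2⟩

/-- The integer vectors in the ball of radius `R` centred at the origin. -/
def intBall (n : ℕ) (R : ℝ) : Finset (Fin n → ℤ) := (finite_intVec_mem_ball R).toFinset

open Classical in
/-- Points of a set of integer points in a ball with integer centre, counted from the origin. -/
theorem ncard_ball_intVec_inter {n : ℕ} {A : Set (Fin n → ℝ)} (hA : A ⊆ intPoints n)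
    (f : Fin n → ℤ) (R : ℝ) :
    (Metric.ball (intVec f) R ∩ A).ncard =
      ((intBall n R).filter fun v => intVec (v + f) ∈ A).card := by
  have hinj : Function.Injective fun v : Fin n → ℤ => intVec (v + f) :=
    intVec_injective.comp (add_left_injective f)
  rw [← Set.ncard_coe_finset, ← Set.ncard_image_of_injective _ hinj]
  congr 1
  ext y
  simp only [Set.mem_inter_iff, Set.mem_image, Finset.mem_coe, Finset.mem_filter, intBall,
    Set.Finite.mem_toFinset, Set.mem_ofPred_eq, mem_ball_zero_iff]
  constructor
  · rintro ⟨hy, hyA⟩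
    obtain ⟨w, rfl⟩ := hA hyA
    refine ⟨w - f, ⟨?_, by simpa using hyA⟩, by simp⟩
    rwa [intVec_sub, ← mem_ball_iff_norm]
  · rintro ⟨v, ⟨hv, hvA⟩, rfl⟩
    refine ⟨?_, hvA⟩
    rwa [intVec_add, mem_ball_iff_norm, add_sub_cancel_right]

open Classical in
theorem HasUnifDensity.tendsto {n : ℕ} {A : Set (Fin n → ℝ)} {d : ℝ} (h : HasUnifDensity A d)
    (hA : A ⊆ intPoints n) (f : Fin n → ℤ) :
    Tendsto (fun R : ℝ => (((intBall n R).filter fun v => intVec (v + f) ∈ A).card : ℝ) /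
      ((intBall n R).card : ℝ)) atTop (nhds d) := by
  rw [Metric.tendsto_atTop]
  intro ε hε
  obtain ⟨R₀, -, hR⟩ := h (ε / 2) (half_pos hε)
  refine ⟨R₀, fun R hRR => ?_⟩
  have key := hR R hRR (intVec f)
  rw [ncard_ball_intVec_inter hA, ncard_ball_intVec_inter subset_rfl,
    Finset.filter_true_of_mem (p := fun v => intVec (v + f) ∈ intPoints n)
      fun v _ => Set.mem_range_self _] at key
  rw [Real.dist_eq]
  linarith

/-- Second moment inequality for the correlations of `Γ` along a finite set of translations. -/
theorem sq_card_mul_density_le_sum {n : ℕ} {Γ : Set (Fin n → ℝ)} (hΓ : Γ ⊆ intPoints n) {D : ℝ}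
    (hD : HasUnifDensity Γ D) {d : (Fin n → ℤ) → ℝ}
    (hd : ∀ v, HasUnifDensity (diffSet Γ (intVec v)) (d v)) (F : Finset (Fin n → ℤ)) :
    (F.card * D) ^ 2 ≤ ∑ f ∈ F, ∑ g ∈ F, d (g - f) := by
  classical
  have h1 := (tendsto_finsetSum F fun f _ => hD.tendsto hΓ f).pow 2
  have h2 := tendsto_finsetSum F fun f _ => tendsto_finsetSum F fun g _ =>
    (hd (g - f)).tendsto (Set.inter_subset_left.trans hΓ) f
  rw [Finset.sum_const, nsmul_eq_mul] at h1
  refine le_of_tendsto_of_tendsto' h1 h2 fun R => ?_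
  let c : (Fin n → ℤ) → (Fin n → ℤ) → ℝ := fun f v => if intVec (v + f) ∈ Γ then 1 else 0
  have hc1 : ∀ f, (((intBall n R).filter fun v => intVec (v + f) ∈ Γ).card : ℝ) =
      ∑ v ∈ intBall n R, c f v := fun f => by simp [c]
  have hc2 : ∀ f g, (((intBall n R).filter fun v =>
      intVec (v + f) ∈ diffSet Γ (intVec (g - f))).card : ℝ) =
      ∑ v ∈ intBall n R, c f v * c g v := fun f g => by
    have : ∀ v, intVec (v + f) ∈ diffSet Γ (intVec (g - f)) ↔
        intVec (v + f) ∈ Γ ∧ intVec (v + g) ∈ Γ := fun v => by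
      rw [diffSet, Set.mem_inter_iff, Set.mem_ofPred_eq, ← intVec_add, add_assoc,
        add_sub_cancel]
    simp only [this, c, ← ite_and, mul_ite, mul_one, mul_zero, Finset.sum_boole, and_comm]
  simp only [hc1, hc2, ← Finset.sum_div]
  have hswap : ∑ f ∈ F, ∑ g ∈ F, ∑ v ∈ intBall n R, c f v * c g v =
      ∑ v ∈ intBall n R, (∑ f ∈ F, c f v) ^ 2 := by
    simp only [sq, Finset.sum_mul_sum]
    rw [Finset.sum_comm]
    refine (Finset.sum_congr rfl fun f _ => Finset.sum_comm).trans ?_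
    rw [Finset.sum_comm]
    exact Finset.sum_congr rfl fun v _ => Finset.sum_comm
  rw [hswap, Finset.sum_comm, div_pow]
  rcases (intBall n R).card.eq_zero_or_pos with h0 | h0
  · simp [h0]
  · have h0' : (0 : ℝ) < (intBall n R).card := by exact_mod_cast h0
    rw [div_le_div_iff₀ (by positivity) h0']
    nlinarith [sq_sum_le_card_mul_sum_sq (s := intBall n R) (f := fun v => ∑ f ∈ F, c f v)]

open scoped Pointwise in
/-- A symmetric convex set of large volume contains all differences of a large finite set of
integer points. -/
theorem exists_finset_sub_mem_of_volume_gt {n : ℕ} (hn : n ≠ 0) {S : Set (Fin n → ℝ)}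
    (hScomp : IsCompact S) (hSconv : Convex ℝ S) (hSsymm : ∀ s ∈ S, -s ∈ S) (k : ℕ)
    (hvol : (4 : ENNReal) ^ n * k < volume S) :
    ∃ F : Finset (Fin n → ℤ), 2 * k < F.card ∧ ∀ f ∈ F, ∀ g ∈ F, intVec (g - f) ∈ S := by
  have hhalf : S = (2 : ℝ) • ((1 / 2 : ℝ) • S) := by rw [smul_smul]; norm_num
  have hvolhalf : ((2 * k : ℕ) : ENNReal) < volume ((1 / 2 : ℝ) • S) := by
    by_contra! h
    refine hvol.not_ge ?_
    rw [hhalf, Measure.addHaar_smul, Module.finrank_fin_fun, abs_of_pos (by positivity),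
      ENNReal.ofReal_pow (by norm_num), ENNReal.ofReal_ofNat]
    calc (2 : ENNReal) ^ n * volume ((1 / 2 : ℝ) • S) ≤ 2 ^ n * (2 * k : ℕ) := by gcongr
      _ ≤ 4 ^ n * k := by
        have h2 : 2 ^ n * (2 * k) ≤ 4 ^ n * k := by
          rw [← mul_assoc, show 4 = 2 * 2 from rfl, mul_pow]
          gcongr
          exact Nat.le_self_pow hn 2
        exact_mod_cast h2
  obtain ⟨x, F, hcard, hF⟩ := exists_finset_card_gt_of_volume_gt
    (hScomp.smul (1 / 2 : ℝ)).measurableSet (2 * k) hvolhalf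
  refine ⟨F, hcard, fun f hf g hg => ?_⟩
  obtain ⟨s, hs, hsf⟩ := Set.mem_smul_set.1 (hF f hf)
  obtain ⟨t, ht, htg⟩ := Set.mem_smul_set.1 (hF g hg)
  have hmem := hSconv ht (hSsymm s hs) (a := 1 / 2) (b := 1 / 2)
    (by norm_num) (by norm_num) (by norm_num)
  rw [smul_neg, hsf, htg] at hmem
  rw [intVec_sub]
  convert hmem using 1
  abel

/-- If `k ≥ 1/D(Γ)` and `S` is a centrally symmetric convex body with `Leb(S) > 4^n k`, then
there is a nonzero integer point `x ∈ S` with `ρ_Γ(x) ≥ D(Γ)/2`. -/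
theorem statement6 {n : ℕ} (Γ : Set (Fin n → ℝ)) (hΓ : AlmostPeriodicPattern Γ)
    (D : ℝ) (hD : HasUnifDensity Γ D) (hDpos : 0 < D)
    (ρ : (Fin n → ℤ) → ℝ)
    (hρ : ∀ v : Fin n → ℤ, HasUnifDensity (diffSet Γ (intVec v)) (ρ v * D))
    (k : ℕ) (hk : 1 ≤ k) (hkD : 1 / D ≤ (k : ℝ))
    (S : Set (Fin n → ℝ)) (hScomp : IsCompact S) (hSconv : Convex ℝ S)
    (hSint : (interior S).Nonempty) (hSsymm : S = -S)
    (hvol : (4 : ENNReal) ^ n * k < MeasureTheory.volume S) :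
    ∃ v : Fin n → ℤ, v ≠ 0 ∧ intVec v ∈ S ∧ D / 2 ≤ ρ v := by
  classical
  obtain rfl | hn := Nat.eq_zero_or_pos n
  · have hle : volume S ≤ 1 := (measure_mono (Set.subset_univ S)).trans <| by
      rw [volume_pi, Measure.pi_univ]
      simp
    have hk' : (1 : ENNReal) ≤ k := by exact_mod_cast hk
    rw [pow_zero, one_mul] at hvol
    exact absurd (hvol.trans_le hle) hk'.not_gt
  have hneg : ∀ s ∈ S, -s ∈ S := fun s hs => by
    rw [hSsymm] at hs
    exact Set.mem_neg.1 hs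
  obtain ⟨F, hcard, hdiff⟩ := exists_finset_sub_mem_of_volume_gt hn.ne' hScomp hSconv hneg k hvol
  by_contra! hcon
  have hρ0 : ρ 0 * D = D := by
    have h0 : diffSet Γ (intVec 0) = Γ := by
      have : intVec (0 : Fin n → ℤ) = 0 := by ext i; simp [intVec]
      ext y
      simp [diffSet, this]
    have hden := hρ 0
    rw [h0] at hden
    exact tendsto_nhds_unique (hden.tendsto hΓ.1 0) (hD.tendsto hΓ.1 0)
  have hmain := sq_card_mul_density_le_sum hΓ.1 hD hρ F
  have hupper : ∑ f ∈ F, ∑ g ∈ F, ρ (g - f) * D ≤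
      F.card * (D + (F.card - 1) * (D / 2 * D)) := by
    rw [← nsmul_eq_mul]
    refine Finset.sum_le_card_nsmul _ _ _ fun f hf => ?_
    rw [← Finset.add_sum_erase F _ hf, sub_self, hρ0]
    have hpos : 1 ≤ F.card := Finset.card_pos.2 ⟨f, hf⟩
    have : ((F.erase f).card : ℝ) = F.card - 1 := by
      rw [Finset.card_erase_of_mem hf, Nat.cast_sub hpos, Nat.cast_one]
    rw [← this, ← nsmul_eq_mul]
    gcongr
    refine Finset.sum_le_card_nsmul _ _ _ fun g hg => ?_
    obtain ⟨hne, hgF⟩ := Finset.mem_erase.1 hg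
    exact mul_le_mul_of_nonneg_right
      (hcon (g - f) (sub_ne_zero.2 hne) (hdiff f hf g hgF)).le hDpos.le
  have hm : (2 * k : ℝ) < F.card := by exact_mod_cast hcard
  have hkD' : 1 ≤ k * D := (div_le_iff₀ hDpos).1 hkD
  have hmD : 2 ≤ F.card * D := by nlinarith
  have hmpos : 0 < F.card * D := by linarith
  have hfin : F.card * D * (F.card * D) ≤ F.card * D * (1 + (F.card - 1) * (D / 2)) := by
    linarith [hmain.trans hupper]
  have := le_of_mul_le_mul_left hfin hmpos
  linarith

end
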